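/- For every prime p < 37 and every pair of nonzero residues b, c ∈ F_p^×, if the curve x^4 + b·y^4 + c·z^4 = 0 has no nonzero F_p-point, then either (p, and the curve up to the equivalence of scaling the equation and multiplying coefficients by fourth powers) is (5, x^4+y^4+z^4), (29, x^4+y^4+z^4), (5, x^4+y^4+2z^4), or (13, x^4+y^4+2z^4). -/

import Mathlib

/-- Two diagonal quartic plane curves over `F_p`, given by coefficient triples
`t` and `s`, are equivalent if one is obtained from the other by permuting the
coefficients, multiplying the whole equation by a nonzero scalar, and
multiplying individual coefficients by fourth powers of units. -/
def DiagQuarticEquiv (p : ℕ) (t s : Fin 3 → ZMod p) : Prop :=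
  ∃ (σ : Equiv.Perm (Fin 3)) (lam : (ZMod p)ˣ) (u : Fin 3 → (ZMod p)ˣ),
    ∀ i, s i = (lam : ZMod p) * t (σ i) * ((u i : ZMod p)) ^ 4

/-- Constructor for equivalences from nonvanishing scalars. -/
theorem equiv_of_scalars {p : ℕ} [Fact p.Prime] {t s : Fin 3 → ZMod p}
    (σ : Equiv.Perm (Fin 3)) (l v w : ZMod p) (hl : l ≠ 0) (hv : v ≠ 0) (hw : w ≠ 0)
    (h0 : s 0 = l * t (σ 0)) (h1 : s 1 = l * t (σ 1) * v ^ 4)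
    (h2 : s 2 = l * t (σ 2) * w ^ 4) : DiagQuarticEquiv p t s := by
  refine ⟨σ, Units.mk0 l hl, ![1, Units.mk0 v hv, Units.mk0 w hw], ?_⟩
  intro i
  fin_cases i
  · simpa using h0
  · simpa using h1
  · simpa using h2

/-- A normalized point: either `x = 1`, or `x = 0` and `y = 1`. -/
def HasPt (p : ℕ) (b c : ZMod p) : Prop :=
  (∃ z : ZMod p, b + c * z ^ 4 = 0) ∨ ∃ y z : ZMod p, 1 + b * y ^ 4 + c * z ^ 4 = 0

theorem point_of_hasPt {p : ℕ} (hp : p.Prime) {b c : ZMod p} (h : HasPt p b c) :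
    ∃ x y z : ZMod p, ¬(x = 0 ∧ y = 0 ∧ z = 0) ∧ x ^ 4 + b * y ^ 4 + c * z ^ 4 = 0 := by
  have := Fact.mk hp
  rcases h with ⟨z, h⟩ | ⟨y, z, h⟩
  · exact ⟨0, 1, z, by simp, by simpa using h⟩
  · exact ⟨1, y, z, by simp, by simpa using h⟩

/-- Being equivalent to `x⁴+y⁴+z⁴`, with explicit scalars. -/
def TypeOne (p : ℕ) (b c : ZMod p) : Prop :=
  (∃ v : ZMod p, 1 = b * v ^ 4) ∧ ∃ w : ZMod p, 1 = c * w ^ 4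

/-- Being equivalent to `x⁴+y⁴+2z⁴`, with explicit scalars. -/
def TypeTwo (p : ℕ) (b c : ZMod p) : Prop :=
  ((∃ v : ZMod p, 1 = b * v ^ 4) ∧ ∃ w : ZMod p, 2 = c * w ^ 4) ∨
  ((∃ v : ZMod p, 1 = c * v ^ 4) ∧ ∃ w : ZMod p, 2 = b * w ^ 4) ∨
  ∃ l : ZMod p, 1 = l * b ∧ (∃ v : ZMod p, 1 = l * c * v ^ 4) ∧ ∃ w : ZMod p, 2 = l * w ^ 4

theorem TypeOne.equiv {p : ℕ} [Fact p.Prime] {b c : ZMod p} (h : TypeOne p b c) :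
    DiagQuarticEquiv p ![1, b, c] ![1, 1, 1] := by
  obtain ⟨⟨v, hv⟩, w, hw⟩ := h
  refine equiv_of_scalars 1 1 v w one_ne_zero ?_ ?_ (by simp) (by simpa using hv)
    (by simpa using hw)
  · rintro rfl; simp at hv
  · rintro rfl; simp at hw

theorem TypeTwo.equiv {p : ℕ} [Fact p.Prime] (h2 : (2 : ZMod p) ≠ 0) {b c : ZMod p}
    (h : TypeTwo p b c) : DiagQuarticEquiv p ![1, b, c] ![1, 1, 2] := by
  rcases h with ⟨⟨v, hv⟩, w, hw⟩ | ⟨⟨v, hv⟩, w, hw⟩ | ⟨l, hl, ⟨v, hv⟩, w, hw⟩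
  · refine equiv_of_scalars 1 1 v w one_ne_zero ?_ ?_ (by simp) (by simpa using hv)
      (by simpa using hw)
    · rintro rfl; simp at hv
    · rintro rfl; simp [h2] at hw
  · refine equiv_of_scalars (Equiv.swap 1 2) 1 v w one_ne_zero ?_ ?_ ?_ (by simpa using hv)
      (by simpa using hw)
    · rintro rfl; simp at hv
    · rintro rfl; simp [h2] at hw
    · rw [show (Equiv.swap (1 : Fin 3) 2) 0 = 0 by decide]; simp
  · refine equiv_of_scalars (finRotate 3) l v w ?_ ?_ ?_ ?_ ?_ ?_
    · rintro rfl; simp at hl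
    · rintro rfl; simp at hv
    · rintro rfl; simp [h2] at hw
    · rw [show (finRotate 3) 0 = 1 by decide]; simpa using hl
    · rw [show (finRotate 3) 1 = 2 by decide]; simpa using hv
    · rw [show (finRotate 3) 2 = 0 by decide]; simpa using hw

/-- Search for a normalized point with coordinates in `L`, in natural numbers. -/
def ptCheck (p : ℕ) (L : List ℕ) (b c : ℕ) : Bool :=
  L.any (fun z => Nat.beq (Nat.mod (Nat.add b (Nat.mul c (Nat.pow z 4))) p) 0) ||
    L.any (fun y => L.any (fun z => Nat.beq (Nat.mod (Nat.add
      (Nat.add 1 (Nat.mul b (Nat.pow y 4))) (Nat.mul c (Nat.pow z 4))) p) 0))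

/-- Search for `v ∈ L` with `b v⁴ = 1`, in natural numbers. -/
def oneCheck (p : ℕ) (L : List ℕ) (b : ℕ) : Bool :=
  L.any (fun v => Nat.beq (b * v ^ 4 % p) (1 % p))

/-- Run the search over all pairs of residues. -/
def allCheck (p : ℕ) (L : List ℕ) (e : Bool) : Bool :=
  (List.range p).all fun b => Nat.beq b 0 || (List.range p).all fun c => Nat.beq c 0 ||
    (ptCheck p L b c || (e && (oneCheck p L b && oneCheck p L c)))

theorem hasPt_of_ptCheck {p : ℕ} {L : List ℕ} {b c : ℕ} (h : ptCheck p L b c = true) :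
    HasPt p (b : ZMod p) (c : ZMod p) := by
  simp only [ptCheck, Bool.or_eq_true, List.any_eq_true, Nat.beq_eq] at h
  rcases h with ⟨z, -, h⟩ | ⟨y, -, z, -, h⟩
  · change (b + c * z ^ 4) % p = 0 at h
    refine Or.inl ⟨z, ?_⟩
    have := (ZMod.natCast_eq_zero_iff _ p).2 (Nat.dvd_of_mod_eq_zero h)
    simpa using this
  · change (1 + b * y ^ 4 + c * z ^ 4) % p = 0 at h
    refine Or.inr ⟨y, z, ?_⟩
    have := (ZMod.natCast_eq_zero_iff _ p).2 (Nat.dvd_of_mod_eq_zero h)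
    simpa using this

theorem exists_of_oneCheck {p : ℕ} {L : List ℕ} {b : ℕ} (h : oneCheck p L b = true) :
    ∃ v : ZMod p, 1 = (b : ZMod p) * v ^ 4 := by
  simp only [oneCheck, List.any_eq_true, Nat.beq_eq] at h
  obtain ⟨v, -, h⟩ := h
  refine ⟨v, ?_⟩
  have := (ZMod.natCast_eq_natCast_iff' _ _ p).2 h
  simpa using this.symm

theorem cases_of_allCheck {p : ℕ} [NeZero p] {L : List ℕ} {e : Bool}
    (h : allCheck p L e = true) (b c : ZMod p) :
    b = 0 ∨ c = 0 ∨ HasPt p b c ∨ (e = true ∧ TypeOne p b c) := by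
  simp only [allCheck, Bool.or_eq_true, Bool.and_eq_true, List.all_eq_true, List.mem_range,
    Nat.beq_eq] at h
  rcases h b.val b.val_lt with h | h
  · exact Or.inl ((ZMod.val_eq_zero b).1 h)
  rcases h c.val c.val_lt with h | h | ⟨he, h1, h2⟩
  · exact Or.inr (Or.inl ((ZMod.val_eq_zero c).1 h))
  · have := hasPt_of_ptCheck h
    rw [ZMod.natCast_zmod_val, ZMod.natCast_zmod_val] at this
    exact Or.inr (Or.inr (Or.inl this))
  · have h1 := exists_of_oneCheck h1
    have h2 := exists_of_oneCheck h2
    rw [ZMod.natCast_zmod_val] at h1 h2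
    exact Or.inr (Or.inr (Or.inr ⟨he, h1, h2⟩))

theorem cases_2 : ∀ b c : ZMod 2, b = 0 ∨ c = 0 ∨ HasPt 2 b c := by
  unfold HasPt
  decide +kernel

theorem cases_3 : ∀ b c : ZMod 3, b = 0 ∨ c = 0 ∨ HasPt 3 b c := by
  unfold HasPt
  decide +kernel

theorem cases_5 : ∀ b c : ZMod 5, b = 0 ∨ c = 0 ∨ HasPt 5 b c ∨ TypeOne 5 b c ∨ TypeTwo 5 b c := by
  unfold HasPt TypeOne TypeTwo
  decide +kernel

theorem cases_7 : ∀ b c : ZMod 7, b = 0 ∨ c = 0 ∨ HasPt 7 b c := by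
  have h : allCheck 7 [0, 1, 2, 3] false = true := by decide +kernel
  intro b c
  simpa using cases_of_allCheck h b c

theorem cases_11 : ∀ b c : ZMod 11, b = 0 ∨ c = 0 ∨ HasPt 11 b c := by
  have h : allCheck 11 [0, 1, 2, 3, 4, 5] false = true := by decide +kernel
  intro b c
  simpa using cases_of_allCheck h b c

theorem cases_13 : ∀ b c : ZMod 13, b = 0 ∨ c = 0 ∨ HasPt 13 b c ∨ TypeTwo 13 b c := by
  unfold HasPt TypeTwo
  decide +kernel

theorem cases_17 : ∀ b c : ZMod 17, b = 0 ∨ c = 0 ∨ HasPt 17 b c := by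
  have h : allCheck 17 [0, 1, 2, 3, 6] false = true := by decide +kernel
  intro b c
  simpa using cases_of_allCheck h b c

theorem cases_19 : ∀ b c : ZMod 19, b = 0 ∨ c = 0 ∨ HasPt 19 b c := by
  have h : allCheck 19 [0, 1, 2, 3, 4, 5, 6, 7, 8, 9] false = true := by decide +kernel
  intro b c
  simpa using cases_of_allCheck h b c

theorem cases_23 : ∀ b c : ZMod 23, b = 0 ∨ c = 0 ∨ HasPt 23 b c := by
  have h : allCheck 23 [0, 1, 2, 3, 4, 5, 6, 7, 8, 9, 10, 11] false = true := by decide +kernel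
  intro b c
  simpa using cases_of_allCheck h b c

theorem cases_29 : ∀ b c : ZMod 29, b = 0 ∨ c = 0 ∨ HasPt 29 b c ∨ TypeOne 29 b c := by
  have h : allCheck 29 [0, 1, 2, 3, 4, 6, 8, 11] true = true := by decide +kernel
  intro b c
  simpa using cases_of_allCheck h b c

theorem cases_31 : ∀ b c : ZMod 31, b = 0 ∨ c = 0 ∨ HasPt 31 b c := by
  have h : allCheck 31 [0, 1, 2, 3, 4, 5, 6, 7, 8, 9, 10, 11, 12, 13, 14, 15] false = true := by decide +kernel
  intro b c
  simpa using cases_of_allCheck h b c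

theorem two_ne_5 : (2 : ZMod 5) ≠ 0 := by decide

theorem two_ne_13 : (2 : ZMod 13) ≠ 0 := by decide

/-- For every prime `p < 37` and nonzero `b, c ∈ F_p`, if the curve
`x⁴ + b·y⁴ + c·z⁴ = 0` has no nonzero `F_p`-point, then `p` and the curve (up
to equivalence) are `(5, x⁴+y⁴+z⁴)`, `(29, x⁴+y⁴+z⁴)`, `(5, x⁴+y⁴+2z⁴)` or
`(13, x⁴+y⁴+2z⁴)`. -/
theorem stmt_14 (p : ℕ) (hp : p.Prime) (h37 : p < 37) (b c : ZMod p)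
    (hb : b ≠ 0) (hc : c ≠ 0)
    (hnosol : ¬ ∃ x y z : ZMod p, ¬(x = 0 ∧ y = 0 ∧ z = 0) ∧
        x ^ 4 + b * y ^ 4 + c * z ^ 4 = 0) :
    (p = 5 ∧ DiagQuarticEquiv p ![1, b, c] ![1, 1, 1]) ∨
    (p = 29 ∧ DiagQuarticEquiv p ![1, b, c] ![1, 1, 1]) ∨
    (p = 5 ∧ DiagQuarticEquiv p ![1, b, c] ![1, 1, 2]) ∨
    (p = 13 ∧ DiagQuarticEquiv p ![1, b, c] ![1, 1, 2]) := by
  have := Fact.mk hp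
  have key : ¬ HasPt p b c := fun h => hnosol (point_of_hasPt hp h)
  clear hnosol
  interval_cases p
  · exact absurd hp (by norm_num)
  · exact absurd hp (by norm_num)
  · rcases cases_2 b c with h | h | h
    · exact absurd h hb
    · exact absurd h hc
    · exact absurd h key
  · rcases cases_3 b c with h | h | h
    · exact absurd h hb
    · exact absurd h hc
    · exact absurd h key
  · exact absurd hp (by norm_num)
  · rcases cases_5 b c with h | h | h | h | h
    · exact absurd h hb
    · exact absurd h hc
    · exact absurd h key
    · exact Or.inl ⟨rfl, h.equiv⟩
    · exact Or.inr (Or.inr (Or.inl ⟨rfl, h.equiv two_ne_5⟩))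
  · exact absurd hp (by norm_num)
  · rcases cases_7 b c with h | h | h
    · exact absurd h hb
    · exact absurd h hc
    · exact absurd h key
  · exact absurd hp (by norm_num)
  · exact absurd hp (by norm_num)
  · exact absurd hp (by norm_num)
  · rcases cases_11 b c with h | h | h
    · exact absurd h hb
    · exact absurd h hc
    · exact absurd h key
  · exact absurd hp (by norm_num)
  · rcases cases_13 b c with h | h | h | h
    · exact absurd h hb
    · exact absurd h hc
    · exact absurd h key
    · exact Or.inr (Or.inr (Or.inr ⟨rfl, h.equiv two_ne_13⟩))
  · exact absurd hp (by norm_num)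
  · exact absurd hp (by norm_num)
  · exact absurd hp (by norm_num)
  · rcases cases_17 b c with h | h | h
    · exact absurd h hb
    · exact absurd h hc
    · exact absurd h key
  · exact absurd hp (by norm_num)
  · rcases cases_19 b c with h | h | h
    · exact absurd h hb
    · exact absurd h hc
    · exact absurd h key
  · exact absurd hp (by norm_num)
  · exact absurd hp (by norm_num)
  · exact absurd hp (by norm_num)
  · rcases cases_23 b c with h | h | h
    · exact absurd h hb
    · exact absurd h hc
    · exact absurd h key
  · exact absurd hp (by norm_num)
  · exact absurd hp (by norm_num)
  · exact absurd hp (by norm_num)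
  · exact absurd hp (by norm_num)
  · exact absurd hp (by norm_num)
  · rcases cases_29 b c with h | h | h | h
    · exact absurd h hb
    · exact absurd h hc
    · exact absurd h key
    · exact Or.inr (Or.inl ⟨rfl, h.equiv⟩)
  · exact absurd hp (by norm_num)
  · rcases cases_31 b c with h | h | h
    · exact absurd h hb
    · exact absurd h hc
    · exact absurd h key
  · exact absurd hp (by norm_num)
  · exact absurd hp (by norm_num)
  · exact absurd hp (by norm_num)
  · exact absurd hp (by norm_num)
  · exact absurd hp (by norm_num)
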